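/- Let n ≥ 3 be an integer, let κ ≥ 4 be real, and let c > 0 and χ > 0 be reals such that q := c²/χ satisfies 0 < q < 1 and such that √χ ≥ πn/(2·E(√q)). If πn/2 − c > (κ/4)·(ln n + 9), then (1 − q)·√χ > κ. -/

import Mathlib

open MeasureTheory

/-- Complete Legendre elliptic integral of the second kind. -/
noncomputable def ellE (k : ℝ) : ℝ :=
  ∫ t in (0:ℝ)..1, Real.sqrt ((1 - k^2 * t^2) / (1 - t^2))

/-- Complete Legendre elliptic integral of the first kind. -/
noncomputable def ellK (k : ℝ) : ℝ :=
  ∫ t in (0:ℝ)..1, 1 / Real.sqrt ((1 - t^2) * (1 - k^2 * t^2))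

/-- The function `Ψ(k) = k / E(k)`. -/
noncomputable def PsiFn (k : ℝ) : ℝ := k / ellE k

/-- `Φ`, the inverse on `[0,1]` of the strictly increasing bijection `Ψ`. -/
noncomputable def PhiFn (x : ℝ) : ℝ :=
  sSup {y : ℝ | y ∈ Set.Icc (0:ℝ) 1 ∧ PsiFn y ≤ x}

/-- The function `𝒥(x) = (π²/4) ∫_{Φ(2x/π)}^1 dt/(t E(t)²)`. -/
noncomputable def Jcal (x : ℝ) : ℝ :=
  (Real.pi^2 / 4) * ∫ t in PhiFn (2*x/Real.pi)..(1:ℝ), 1 / (t * (ellE t)^2)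

/-- The function `𝒥_l(c) = (π/2) ∫_c^{πl/2} dτ/(Φ(2τ/(πl)) K(Φ(2τ/(πl))))`. -/
noncomputable def Jl (l c : ℝ) : ℝ :=
  (Real.pi / 2) * ∫ τ in c..(Real.pi * l / 2),
    1 / (PhiFn (2*τ/(Real.pi*l)) * ellK (PhiFn (2*τ/(Real.pi*l))))

/-- The approximation `λ̃_n(c)`. -/
noncomputable def lambdaTilde (n : ℕ) (c : ℝ) : ℝ :=
  (1/2) * Real.exp (-(Real.pi^2 * ((n:ℝ) + 1/2) / 2) *
    ∫ t in PhiFn (2*c/(Real.pi*((n:ℝ)+1/2)))..(1:ℝ), 1 / (t * (ellE t)^2))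

/-- The kernel `sin(c(x-y))/(π(x-y))`, with value `c/π` on the diagonal. -/
noncomputable def sincKernel (c x y : ℝ) : ℝ :=
  if x = y then c / Real.pi else Real.sin (c*(x-y)) / (Real.pi * (x-y))

/-- The quadratic form `⟨Q_c f, f⟩` of the time-and-frequency limiting operator `Q_c`. -/
noncomputable def QForm (c : ℝ) (f : ℝ → ℝ) : ℝ :=
  ∫ x in Set.Ioo (-1:ℝ) 1, ∫ y in Set.Ioo (-1:ℝ) 1, sincKernel c x y * f y * f x

/-- The `(n+1)`-st eigenvalue `λ_n(c)` of `Q_c`, via the Courant–Fischer min-max principle. -/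
noncomputable def lambda (n : ℕ) (c : ℝ) : ℝ :=
  ⨆ V : {V : Submodule ℝ (Lp ℝ 2 (volume.restrict (Set.Ioo (-1:ℝ) 1))) //
          Module.finrank ℝ V = n + 1},
    ⨅ f : {f : Lp ℝ 2 (volume.restrict (Set.Ioo (-1:ℝ) 1)) // f ∈ V.1 ∧ f ≠ 0},
      QForm c (f.1 : ℝ → ℝ) / ‖f.1‖^2

/-- The primitive of `√((x + a) / x)`. -/
noncomputable def sqrtRatioPrimitive (a x : ℝ) : ℝ :=
  √x * √(x + a) + a * Real.log (√x + √(x + a))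

lemma hasDerivAt_sqrtRatioPrimitive {a x : ℝ} (ha : 0 < a) (hx : 0 < x) :
    HasDerivAt (sqrtRatioPrimitive a) (√(x + a) / √x) x := by
  have hP : 0 < √x := Real.sqrt_pos.2 hx
  have hQ : 0 < √(x + a) := Real.sqrt_pos.2 (by linarith)
  have hP2 : √x ^ 2 = x := Real.sq_sqrt hx.le
  have hQ2 : √(x + a) ^ 2 = x + a := Real.sq_sqrt (by linarith)
  have dP : HasDerivAt (fun y : ℝ => √y) (1 / (2 * √x)) x := Real.hasDerivAt_sqrt hx.ne'
  have dQ : HasDerivAt (fun y : ℝ => √(y + a)) (1 / (2 * √(x + a))) x :=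
    ((hasDerivAt_id x).add_const a).sqrt (by simp only [id]; linarith)
  have h := (dP.mul dQ).add (((dP.add dQ).log
    (by simp only [Pi.add_apply]; positivity)).const_mul a)
  refine h.congr_deriv ?_
  simp only [Pi.add_apply]
  have e : a = √(x + a) ^ 2 - √x ^ 2 := by rw [hP2, hQ2]; ring
  generalize √x = P at *
  generalize √(x + a) = Q at *
  subst e
  field_simp
  ring

lemma continuousOn_sqrtRatioPrimitive {a : ℝ} (ha : 0 < a) :
    ContinuousOn (sqrtRatioPrimitive a) (Set.Ici 0) := by
  unfold sqrtRatioPrimitive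
  refine ContinuousOn.add (by fun_prop) (ContinuousOn.mul continuousOn_const
    (ContinuousOn.log (by fun_prop) ?_))
  intro x hx
  have hx : 0 ≤ x := hx
  have : 0 < √(x + a) := Real.sqrt_pos.2 (by linarith)
  positivity

lemma intervalIntegrable_integral_sqrtRatio {a : ℝ} (ha : 0 < a) :
    IntervalIntegrable (fun t : ℝ => √(1 - t + a) / √(1 - t)) volume 0 1 ∧
    ∫ t in (0:ℝ)..1, √(1 - t + a) / √(1 - t) =
      sqrtRatioPrimitive a 1 - sqrtRatioPrimitive a 0 := by
  have hcont : ContinuousOn (fun t : ℝ => -sqrtRatioPrimitive a (1 - t)) (Set.Icc 0 1) :=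
    ((continuousOn_sqrtRatioPrimitive ha).comp (by fun_prop)
      (fun t ht => by simpa using ht.2)).neg
  have hd : ∀ t ∈ Set.Ioo (0:ℝ) 1, HasDerivAt (fun t : ℝ => -sqrtRatioPrimitive a (1 - t))
      (√(1 - t + a) / √(1 - t)) t := by
    intro t ht
    have h := (hasDerivAt_sqrtRatioPrimitive ha (sub_pos.2 ht.2)).comp_const_sub 1 t
    exact h.neg.congr_deriv (neg_neg _)
  have hint : IntervalIntegrable (fun t : ℝ => √(1 - t + a) / √(1 - t)) volume 0 1 := by
    refine intervalIntegral.intervalIntegrable_deriv_of_nonneg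
      (g := fun t : ℝ => -sqrtRatioPrimitive a (1 - t)) ?_ ?_ ?_
    · rwa [Set.uIcc_of_le zero_le_one]
    · simpa using hd
    · intro t _
      positivity
  refine ⟨hint, ?_⟩
  rw [intervalIntegral.integral_eq_sub_of_hasDerivAt_of_le zero_le_one hcont hd hint]
  simp only [sub_self, sub_zero]
  ring

lemma ellE_integrand_le {k t : ℝ} (hk : k ^ 2 ≤ 1) (ht : t ∈ Set.Ioo (0:ℝ) 1) :
    √((1 - k ^ 2 * t ^ 2) / (1 - t ^ 2)) ≤ √(1 - t + (1 - k ^ 2) / 2) / √(1 - t) := by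
  obtain ⟨h0, h1⟩ := ht
  rw [← Real.sqrt_div (by linarith)]
  apply Real.sqrt_le_sqrt
  rw [div_le_div_iff₀ (by nlinarith) (by linarith)]
  nlinarith [mul_nonneg (mul_nonneg (sub_nonneg.2 hk) (sub_nonneg.2 h1.le))
    (mul_nonneg (sub_nonneg.2 h1.le) (by linarith : (0:ℝ) ≤ 1 + 2 * t))]

lemma one_le_ellE_integrand {k t : ℝ} (hk : k ^ 2 ≤ 1) (ht : t ∈ Set.Ioo (0:ℝ) 1) :
    1 ≤ √((1 - k ^ 2 * t ^ 2) / (1 - t ^ 2)) := by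
  obtain ⟨h0, h1⟩ := ht
  rw [Real.one_le_sqrt, one_le_div (by nlinarith)]
  nlinarith [mul_nonneg (sub_nonneg.2 hk) (sq_nonneg t)]

lemma intervalIntegrable_ellE_integrand {k : ℝ} (hk : k ^ 2 < 1) :
    IntervalIntegrable (fun t : ℝ => √((1 - k ^ 2 * t ^ 2) / (1 - t ^ 2))) volume 0 1 := by
  have hg := (intervalIntegrable_integral_sqrtRatio
    (by linarith : 0 < (1 - k ^ 2) / 2)).1
  rw [intervalIntegrable_iff_integrableOn_Ioo_of_le zero_le_one] at hg ⊢
  refine Integrable.mono' hg (Measurable.aestronglyMeasurable (by fun_prop)) ?_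
  filter_upwards [ae_restrict_mem measurableSet_Ioo] with t ht
  rw [Real.norm_of_nonneg (Real.sqrt_nonneg _)]
  exact ellE_integrand_le hk.le ht

lemma one_le_ellE {k : ℝ} (hk : k ^ 2 < 1) : 1 ≤ ellE k := by
  have h := intervalIntegral.integral_mono_on_of_le_Ioo (zero_le_one (α := ℝ))
    (intervalIntegrable_const (c := (1:ℝ)) (μ := volume))
    (intervalIntegrable_ellE_integrand hk) (fun t ht => one_le_ellE_integrand hk.le ht)
  simpa [ellE] using h

lemma ellE_le_sqrtRatioPrimitive_sub {k : ℝ} (hk : k ^ 2 < 1) :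
    ellE k ≤ sqrtRatioPrimitive ((1 - k ^ 2) / 2) 1 -
      sqrtRatioPrimitive ((1 - k ^ 2) / 2) 0 := by
  obtain ⟨hg, hG⟩ := intervalIntegrable_integral_sqrtRatio
    (by linarith : 0 < (1 - k ^ 2) / 2)
  rw [← hG]
  exact intervalIntegral.integral_mono_on_of_le_Ioo zero_le_one
    (intervalIntegrable_ellE_integrand hk) hg (fun t ht => ellE_integrand_le hk.le ht)

lemma log_eighteen_le : Real.log 18 ≤ 7 / 2 := by
  have h : Real.log 18 ≤ Real.log (2 ^ 5) := Real.log_le_log (by norm_num) (by norm_num)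
  rw [Real.log_pow] at h
  have := Real.log_two_lt_d9
  norm_num at h
  linarith

/-- The logarithmic upper bound for `E(k) - k`, sharp to leading order as `k → 1`. -/
lemma ellE_sub_le {k : ℝ} (hk0 : 0 ≤ k) (hk : k ^ 2 < 1) :
    ellE k - k ≤ (1 - k ^ 2) / 4 * (17 / 2 - Real.log (1 - k ^ 2)) := by
  have hE := ellE_le_sqrtRatioPrimitive_sub hk
  have hk1 : k ≤ 1 := by nlinarith
  have hmk : 1 - k ≤ 1 - k ^ 2 := by nlinarith
  have hm1 : 1 - k ^ 2 ≤ 1 := by nlinarith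
  have hm : 0 < 1 - k ^ 2 := by linarith
  generalize 1 - k ^ 2 = m at *
  have hs : √(1 + m / 2) ≤ 1 + m / 4 := Real.sqrt_le_iff.2 ⟨by linarith, by nlinarith⟩
  have hlog : Real.log (1 + √(1 + m / 2)) ≤ Real.log 3 :=
    Real.log_le_log (by positivity) (by linarith)
  have h18 : Real.log 18 = 2 * Real.log 3 + Real.log 2 := by
    rw [show (18:ℝ) = 3 ^ 2 * 2 by norm_num, Real.log_mul (by norm_num) (by norm_num),
      Real.log_pow]
    norm_num
  have h18' := log_eighteen_le
  simp only [sqrtRatioPrimitive, Real.sqrt_one, Real.sqrt_zero, zero_mul, zero_add, one_mul]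
    at hE
  rw [Real.log_sqrt (by positivity), Real.log_div hm.ne' two_ne_zero] at hE
  nlinarith [mul_le_mul_of_nonneg_left hlog hm.le, mul_le_mul_of_nonneg_left h18' hm.le]

theorem stmt19 (n : ℕ) (hn : 3 ≤ n) (κ c χ : ℝ) (hκ : 4 ≤ κ)
    (hc : 0 < c) (hχ : 0 < χ) (hq : c^2/χ < 1)
    (hlow : Real.pi * n / (2 * ellE (Real.sqrt (c^2/χ))) ≤ Real.sqrt χ)
    (hcond : Real.pi * n / 2 - c > κ/4 * (Real.log n + 9)) :
    (1 - c^2/χ) * Real.sqrt χ > κ := by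
  set s := Real.sqrt χ with hs
  have hs0 : 0 < s := Real.sqrt_pos.2 hχ
  have hs2 : s ^ 2 = χ := Real.sq_sqrt hχ.le
  have hk : Real.sqrt (c ^ 2 / χ) = c / s := by
    rw [Real.sqrt_div (sq_nonneg c), Real.sqrt_sq hc.le]
  have hkq : (c / s) ^ 2 = c ^ 2 / χ := by rw [div_pow, hs2]
  have hcs : c = s * (c / s) := by field_simp
  rw [hk] at hlow
  rw [← hkq] at hq ⊢
  have hk0 : 0 < c / s := by positivity
  generalize c / s = k at *
  have hE1 := one_le_ellE hq
  have hE2 := ellE_sub_le hk0.le hq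
  have hn1 : (1:ℝ) ≤ n := by exact_mod_cast (by omega : 1 ≤ n)
  have hln : 0 ≤ Real.log n := Real.log_nonneg hn1
  rw [div_le_iff₀ (by linarith)] at hlow
  have hm : 0 < 1 - k ^ 2 := by linarith
  by_contra! hu
  have hsE : s * (ellE k - k) ≤
      s * ((1 - k ^ 2) / 4 * (17 / 2 - Real.log (1 - k ^ 2))) :=
    mul_le_mul_of_nonneg_left hE2 hs0.le
  have hlt : κ / 4 * (Real.log n + 9) < s * (ellE k - k) := by linarith
  have hu0 : 0 < (1 - k ^ 2) * s := by positivity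
  rcases le_total k (1 / 2) with hk2 | hk2
  · have h1 : -Real.log (1 - k ^ 2) ≤ (1 - k ^ 2)⁻¹ - 1 := by
      rw [← Real.log_inv]
      exact Real.log_le_sub_one_of_pos (inv_pos.2 hm)
    have h2 : (1 - k ^ 2)⁻¹ ≤ (3 / 4)⁻¹ := inv_anti₀ (by norm_num) (by nlinarith)
    have h3 : (1 - k ^ 2) * s * (17 / 2 - Real.log (1 - k ^ 2)) ≤ (1 - k ^ 2) * s * 9 :=
      mul_le_mul_of_nonneg_left (by norm_num at h2; linarith) hu0.le
    nlinarith
  · have hsn : s ≤ κ * n := by nlinarith [Real.pi_lt_four, Real.pi_pos]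
    have h1 : -Real.log (1 - k ^ 2) ≤ Real.log n + (κ / ((1 - k ^ 2) * s) - 1) := by
      have h2 : Real.log (κ / ((1 - k ^ 2) * s)) ≤ κ / ((1 - k ^ 2) * s) - 1 :=
        Real.log_le_sub_one_of_pos (by positivity)
      have h3 : Real.log s ≤ Real.log κ + Real.log n := by
        rw [← Real.log_mul (by positivity) (by positivity)]
        exact Real.log_le_log hs0 hsn
      rw [Real.log_div (by positivity) hu0.ne', Real.log_mul hm.ne' hs0.ne'] at h2
      linarith
    have h4 := mul_le_mul_of_nonneg_left h1 hu0.le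
    have h5 : (1 - k ^ 2) * s * (κ / ((1 - k ^ 2) * s)) = κ := mul_div_cancel₀ _ hu0.ne'
    have h6 : (1 - k ^ 2) * s * (Real.log n + 15 / 2) ≤ κ * (Real.log n + 15 / 2) :=
      mul_le_mul_of_nonneg_right hu (by linarith)
    nlinarith
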